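/- Let ω be continuous on [0,1]. The depth function d(θ) = ∫₀¹ (θ² − 2Ω(τ))^{−1/2} dτ is differentiable on (θ₀, ∞) with derivative d′(θ) = −θ ∫₀¹ (θ² − 2Ω(τ))^{−3/2} dτ < 0; in particular d is strictly decreasing on (θ₀, ∞), and d(θ) → 0 as θ → ∞. -/

import Mathlib

/-- `Omg ω τ = ∫₀^τ ω(s) ds`. -/
noncomputable def Omg (ω : ℝ → ℝ) (τ : ℝ) : ℝ := ∫ s in (0:ℝ)..τ, ω s

/-- `theta0 ω = √(2 · max_{τ∈[0,1]} Ω(τ))`. -/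
noncomputable def theta0 (ω : ℝ → ℝ) : ℝ := Real.sqrt (2 * sSup (Omg ω '' Set.Icc 0 1))

/-- `dfun ω θ = ∫₀¹ (θ² − 2Ω(τ))^{−1/2} dτ`. -/
noncomputable def dfun (ω : ℝ → ℝ) (θ : ℝ) : ℝ :=
  ∫ τ in (0:ℝ)..1, 1 / Real.sqrt (θ ^ 2 - 2 * Omg ω τ)

theorem continuousOn_Omg {ω : ℝ → ℝ} (hω : ContinuousOn ω (Set.Icc 0 1)) :
    ContinuousOn (Omg ω) (Set.Icc 0 1) := by
  have h := intervalIntegral.continuousOn_primitive_interval (μ := MeasureTheory.volume)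
    (f := ω) (a := 0) (b := 1)
    (by rw [Set.uIcc_of_le zero_le_one]; exact hω.integrableOn_Icc)
  rwa [Set.uIcc_of_le zero_le_one] at h

theorem theta0_nonneg (ω : ℝ → ℝ) : 0 ≤ theta0 ω := Real.sqrt_nonneg _

theorem two_mul_Omg_le_theta0_sq {ω : ℝ → ℝ} (hω : ContinuousOn ω (Set.Icc 0 1)) {τ : ℝ}
    (hτ : τ ∈ Set.Icc (0 : ℝ) 1) : 2 * Omg ω τ ≤ theta0 ω ^ 2 := by
  have hbdd : BddAbove (Omg ω '' Set.Icc 0 1) :=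
    (isCompact_Icc.image_of_continuousOn (continuousOn_Omg hω)).bddAbove
  have hle : ∀ t ∈ Set.Icc (0 : ℝ) 1, Omg ω t ≤ sSup (Omg ω '' Set.Icc 0 1) :=
    fun t ht => le_csSup hbdd (Set.mem_image_of_mem _ ht)
  have h0 : 0 ≤ sSup (Omg ω '' Set.Icc 0 1) := by
    simpa [Omg] using hle 0 (by simp)
  rw [theta0, Real.sq_sqrt (by positivity)]
  linarith [hle τ hτ]

theorem sq_sub_two_mul_Omg_pos {ω : ℝ → ℝ} (hω : ContinuousOn ω (Set.Icc 0 1)) {θ τ : ℝ}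
    (hθ : theta0 ω < θ) (hτ : τ ∈ Set.Icc (0 : ℝ) 1) : 0 < θ ^ 2 - 2 * Omg ω τ := by
  have h := pow_lt_pow_left₀ hθ (theta0_nonneg ω) two_ne_zero
  linarith [two_mul_Omg_le_theta0_sq hω hτ]

theorem intervalIntegrable_one_div_sqrt_pow {ω : ℝ → ℝ} (hω : ContinuousOn ω (Set.Icc 0 1))
    {θ : ℝ} (hθ : theta0 ω < θ) (n : ℕ) :
    IntervalIntegrable (fun τ => 1 / Real.sqrt (θ ^ 2 - 2 * Omg ω τ) ^ n)
      MeasureTheory.volume 0 1 := by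
  refine ContinuousOn.intervalIntegrable ?_
  rw [Set.uIcc_of_le zero_le_one]
  refine continuousOn_const.div
    ((continuousOn_const.sub (continuousOn_const.mul (continuousOn_Omg hω))).sqrt.pow n) ?_
  intro τ hτ
  exact pow_ne_zero _ (Real.sqrt_ne_zero'.2 (sq_sub_two_mul_Omg_pos hω hθ hτ))

theorem hasDerivAt_one_div_sqrt_sq_sub {c x : ℝ} (h : 0 < x ^ 2 - c) :
    HasDerivAt (fun y => 1 / Real.sqrt (y ^ 2 - c)) (-x * (1 / Real.sqrt (x ^ 2 - c) ^ 3)) x := by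
  have hs : Real.sqrt (x ^ 2 - c) ≠ 0 := Real.sqrt_ne_zero'.2 h
  have hd := ((((hasDerivAt_pow 2 x).sub_const c).sqrt h.ne').inv hs)
  simp only [one_div]
  refine hd.congr_deriv ?_
  field_simp
  simp

theorem hasDerivAt_dfun {ω : ℝ → ℝ} (hω : ContinuousOn ω (Set.Icc 0 1)) {θ : ℝ}
    (hθ : theta0 ω < θ) :
    HasDerivAt (dfun ω)
      (-θ * ∫ τ in (0:ℝ)..1, 1 / (Real.sqrt (θ ^ 2 - 2 * Omg ω τ)) ^ 3) θ := by
  obtain ⟨η, hη, hηθ⟩ := exists_between hθ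
  have hη0 : 0 < η := (theta0_nonneg ω).trans_lt hη
  have hIoc : ∀ {t : ℝ}, t ∈ Set.uIoc (0 : ℝ) 1 → t ∈ Set.Icc (0 : ℝ) 1 := fun ht =>
    Set.Ioc_subset_Icc_self (by rwa [Set.uIoc_of_le zero_le_one] at ht)
  have hint : ∀ {x : ℝ}, theta0 ω < x → IntervalIntegrable
      (fun τ => 1 / Real.sqrt (x ^ 2 - 2 * Omg ω τ)) MeasureTheory.volume 0 1 := fun hx => by
    simpa only [pow_one] using intervalIntegrable_one_div_sqrt_pow hω hx 1
  have key := intervalIntegral.hasDerivAt_integral_of_dominated_loc_of_deriv_le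
    (μ := MeasureTheory.volume) (a := 0) (b := 1) (x₀ := θ) (s := Set.Ioo η (θ + 1))
    (F := fun x τ => 1 / Real.sqrt (x ^ 2 - 2 * Omg ω τ))
    (F' := fun x τ => -x * (1 / Real.sqrt (x ^ 2 - 2 * Omg ω τ) ^ 3))
    (bound := fun τ => (θ + 1) * (1 / Real.sqrt (η ^ 2 - 2 * Omg ω τ) ^ 3))
    (Ioo_mem_nhds hηθ (lt_add_one θ))
    (by
      filter_upwards [Ioi_mem_nhds hθ] with x hx
      exact (hint hx).def'.aestronglyMeasurable)
    (hint hθ)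
    ((intervalIntegrable_one_div_sqrt_pow hω hθ 3).const_mul _).def'.aestronglyMeasurable
    (Filter.Eventually.of_forall fun t ht x hx => by
      have hpos := Real.sqrt_pos.2 (sq_sub_two_mul_Omg_pos hω hη (hIoc ht))
      have hx0 : 0 < x := hη0.trans hx.1
      rw [norm_mul, norm_neg, Real.norm_of_nonneg hx0.le,
        Real.norm_of_nonneg (by positivity)]
      have hηx : η ≤ x := hx.1.le
      have hxθ : x ≤ θ + 1 := hx.2.le
      have hθ0 : 0 ≤ θ + 1 := hx0.le.trans hxθ
      gcongr)
    ((intervalIntegrable_one_div_sqrt_pow hω hη 3).const_mul _)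
    (Filter.Eventually.of_forall fun t ht x hx =>
      hasDerivAt_one_div_sqrt_sq_sub (sq_sub_two_mul_Omg_pos hω (hη.trans hx.1) (hIoc ht)))
  simpa only [intervalIntegral.integral_const_mul] using! key.2

theorem deriv_dfun_neg {ω : ℝ → ℝ} (hω : ContinuousOn ω (Set.Icc 0 1)) {θ : ℝ}
    (hθ : theta0 ω < θ) :
    -θ * (∫ τ in (0:ℝ)..1, 1 / (Real.sqrt (θ ^ 2 - 2 * Omg ω τ)) ^ 3) < 0 := by
  refine mul_neg_of_neg_of_pos (neg_lt_zero.2 ((theta0_nonneg ω).trans_lt hθ))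
    (intervalIntegral.intervalIntegral_pos_of_pos_on
      (intervalIntegrable_one_div_sqrt_pow hω hθ 3) (fun τ hτ => ?_) zero_lt_one)
  have := Real.sqrt_pos.2 (sq_sub_two_mul_Omg_pos hω hθ (Set.Ioo_subset_Icc_self hτ))
  positivity

theorem norm_dfun_le {ω : ℝ → ℝ} (hω : ContinuousOn ω (Set.Icc 0 1)) {θ : ℝ}
    (hθ : theta0 ω < θ) : ‖dfun ω θ‖ ≤ (Real.sqrt (θ ^ 2 - theta0 ω ^ 2))⁻¹ := by
  have h := intervalIntegral.norm_integral_le_of_norm_le_const (a := 0) (b := 1)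
    (f := fun τ => 1 / Real.sqrt (θ ^ 2 - 2 * Omg ω τ))
    (C := (Real.sqrt (θ ^ 2 - theta0 ω ^ 2))⁻¹) (fun τ hτ => by
      rw [Set.uIoc_of_le zero_le_one] at hτ
      have hpos : 0 < Real.sqrt (θ ^ 2 - theta0 ω ^ 2) :=
        Real.sqrt_pos.2 (sub_pos.2 (pow_lt_pow_left₀ hθ (theta0_nonneg ω) two_ne_zero))
      have hle := two_mul_Omg_le_theta0_sq hω (Set.Ioc_subset_Icc_self hτ)
      rw [Real.norm_of_nonneg (by positivity), one_div]
      gcongr)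
  simpa [dfun] using h

theorem tendsto_dfun_atTop {ω : ℝ → ℝ} (hω : ContinuousOn ω (Set.Icc 0 1)) :
    Filter.Tendsto (dfun ω) Filter.atTop (nhds 0) := by
  refine squeeze_zero_norm' ((Filter.eventually_gt_atTop (theta0 ω)).mono
    fun θ hθ => norm_dfun_le hω hθ) ?_
  refine (Real.tendsto_sqrt_atTop.comp ?_).inv_tendsto_atTop
  simpa only [sub_eq_add_neg] using Filter.tendsto_atTop_add_const_right _ (-theta0 ω ^ 2)
    (Filter.tendsto_pow_atTop two_ne_zero)

/-- the depth function `d` is differentiable on `(θ₀,∞)` with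
`d′(θ) = −θ ∫₀¹ (θ²−2Ω(τ))^{−3/2} dτ < 0`, is strictly decreasing there, and tends to `0`
as `θ → ∞`. -/
theorem stmt2 (ω : ℝ → ℝ) (hω : ContinuousOn ω (Set.Icc 0 1)) :
    (∀ θ ∈ Set.Ioi (theta0 ω),
      HasDerivAt (dfun ω)
        (-θ * ∫ τ in (0:ℝ)..1, 1 / (Real.sqrt (θ ^ 2 - 2 * Omg ω τ)) ^ 3) θ ∧
      -θ * (∫ τ in (0:ℝ)..1, 1 / (Real.sqrt (θ ^ 2 - 2 * Omg ω τ)) ^ 3) < 0) ∧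
    StrictAntiOn (dfun ω) (Set.Ioi (theta0 ω)) ∧
    Filter.Tendsto (dfun ω) Filter.atTop (nhds 0) := by
  have hd : ∀ θ ∈ Set.Ioi (theta0 ω), HasDerivAt (dfun ω)
      (-θ * ∫ τ in (0:ℝ)..1, 1 / (Real.sqrt (θ ^ 2 - 2 * Omg ω τ)) ^ 3) θ :=
    fun θ hθ => hasDerivAt_dfun hω hθ
  refine ⟨fun θ hθ => ⟨hd θ hθ, deriv_dfun_neg hω hθ⟩, ?_, tendsto_dfun_atTop hω⟩
  refine strictAntiOn_of_deriv_neg (convex_Ioi _)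
    (fun θ hθ => (hd θ hθ).continuousAt.continuousWithinAt) fun θ hθ => ?_
  rw [interior_Ioi] at hθ
  rw [(hd θ hθ).deriv]
  exact deriv_dfun_neg hω hθ
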